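/- Fix a time t and let f assign a nonnegative real flow to each pair of intervals at time t. Let e_1 = (J_1, J_4) and e_2 = (J_2, J_3) be crossing edges: J_1 ≤ J_2 ≤ J_3 ≤ J_4 in nondecreasing order of position, each interval containing an integer of [0,M], with J_1 strictly below J_2 and J_3 strictly below J_4, and f(e_1) > 0, f(e_2) > 0. Let f′ be obtained from f by decreasing the flow on e_1 and e_2 by f_m = min(f(e_1), f(e_2)) and increasing the flow on e_3 = (J_1, J_3) and e_4 = (J_2, J_4) by f_m. Then for every target a, Σ_e f′(e)·c_t(e, a)·w(a,t) ≤ Σ_e f(e)·c_t(e, a)·w(a,t); hence resolving a crossing flow does not increase the cost of the canonical flow. -/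

import Mathlib

open scoped Classical

/-- Gap indicator `c_t(I, I', a)` for a pair of intervals `I = [s,f)` below
`I' = [s',f')`: it is `1` iff the target position `posat` lies (weakly) above
`I` and strictly below `I'` and no integer patrol position of
`(I ∪ I') ∩ [0,M]` is within the protection radius `R` of `posat`. -/
noncomputable def cMid (M : ℕ) (R posat : ℝ) (I I' : ℝ × ℝ) : ℝ :=
  if I.2 ≤ posat ∧ posat < I'.1 ∧
      ¬∃ z : ℤ, 0 ≤ (z : ℝ) ∧ (z : ℝ) ≤ (M : ℝ) ∧
        ((I.1 ≤ (z : ℝ) ∧ (z : ℝ) < I.2) ∨ (I'.1 ≤ (z : ℝ) ∧ (z : ℝ) < I'.2)) ∧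
        |posat - (z : ℝ)| ≤ R
  then 1 else 0

/-- Border gap indicator `c_t(∅, I', a)`. -/
noncomputable def cLeft (M : ℕ) (R posat : ℝ) (I' : ℝ × ℝ) : ℝ :=
  if posat < I'.1 ∧
      ¬∃ z : ℤ, 0 ≤ (z : ℝ) ∧ (z : ℝ) ≤ (M : ℝ) ∧
        I'.1 ≤ (z : ℝ) ∧ (z : ℝ) < I'.2 ∧ |posat - (z : ℝ)| ≤ R
  then 1 else 0

/-- Border gap indicator `c_t(I, ∅, a)`. -/
noncomputable def cRight (M : ℕ) (R posat : ℝ) (I : ℝ × ℝ) : ℝ :=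
  if I.2 ≤ posat ∧
      ¬∃ z : ℤ, 0 ≤ (z : ℝ) ∧ (z : ℝ) ≤ (M : ℝ) ∧
        I.1 ≤ (z : ℝ) ∧ (z : ℝ) < I.2 ∧ |posat - (z : ℝ)| ≤ R
  then 1 else 0

theorem ite_one_zero_mono {p q : Prop} [Decidable p] [Decidable q] (h : p → q) :
    (if p then (1 : ℝ) else 0) ≤ if q then 1 else 0 := by
  by_cases hp : p
  · simp [hp, h hp]
  · simp only [hp, if_false]
    positivity

theorem cMid_eq_cRight_mul_cLeft (M : ℕ) (R p : ℝ) (I I' : ℝ × ℝ) :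
    cMid M R p I I' = cRight M R p I * cLeft M R p I' := by
  unfold cMid cRight cLeft
  rw [ite_zero_mul_ite_zero, mul_one]
  refine if_congr ⟨?_, ?_⟩ rfl rfl
  · rintro ⟨h, h', hz⟩
    exact ⟨⟨h, fun ⟨z, h0, hM, hs, hf, hR⟩ => hz ⟨z, h0, hM, Or.inl ⟨hs, hf⟩, hR⟩⟩,
      h', fun ⟨z, h0, hM, hs, hf, hR⟩ => hz ⟨z, h0, hM, Or.inr ⟨hs, hf⟩, hR⟩⟩
  · rintro ⟨⟨h, hz⟩, h', hz'⟩
    refine ⟨h, h', ?_⟩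
    rintro ⟨z, h0, hM, ⟨hs, hf⟩ | ⟨hs, hf⟩, hR⟩
    · exact hz ⟨z, h0, hM, hs, hf, hR⟩
    · exact hz' ⟨z, h0, hM, hs, hf, hR⟩

/-- If an occupied interval below the target fails to protect it, so does every lower interval. -/
theorem cRight_le_cRight {M : ℕ} {R p : ℝ} {I I' : ℝ × ℝ} (hI' : I'.1 ≤ I'.2) (h : I.2 ≤ I'.1)
    (hocc : ∃ z : ℤ, 0 ≤ (z : ℝ) ∧ (z : ℝ) ≤ (M : ℝ) ∧ I'.1 ≤ (z : ℝ) ∧ (z : ℝ) < I'.2) :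
    cRight M R p I' ≤ cRight M R p I := by
  obtain ⟨y, hy0, hyM, hys, hyf⟩ := hocc
  unfold cRight
  refine ite_one_zero_mono ?_
  rintro ⟨hp, hn⟩
  refine ⟨by linarith, ?_⟩
  rintro ⟨z, -, -, -, hzf, hzR⟩
  refine hn ⟨y, hy0, hyM, hys, hyf, ?_⟩
  rw [abs_le] at hzR ⊢
  constructor <;> linarith

/-- If an occupied interval above the target fails to protect it, so does every higher interval. -/
theorem cLeft_le_cLeft {M : ℕ} {R p : ℝ} {I I' : ℝ × ℝ} (hI : I.1 ≤ I.2) (h : I.2 ≤ I'.1)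
    (hocc : ∃ z : ℤ, 0 ≤ (z : ℝ) ∧ (z : ℝ) ≤ (M : ℝ) ∧ I.1 ≤ (z : ℝ) ∧ (z : ℝ) < I.2) :
    cLeft M R p I ≤ cLeft M R p I' := by
  obtain ⟨y, hy0, hyM, hys, hyf⟩ := hocc
  unfold cLeft
  refine ite_one_zero_mono ?_
  rintro ⟨hp, hn⟩
  refine ⟨by linarith, ?_⟩
  rintro ⟨z, -, -, hzs, -, hzR⟩
  refine hn ⟨y, hy0, hyM, hys, hyf, ?_⟩
  rw [abs_le] at hzR ⊢
  constructor <;> linarith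

theorem sum_ite_eq_or_eq_mul {α : Type*} [Fintype α] [DecidableEq α] {x y : α} (hxy : x ≠ y) (m : ℝ)
    (g : α → ℝ) : ∑ e, (if e = x ∨ e = y then m else 0) * g e = m * (g x + g y) := by
  have h : ∀ e, (if e = x ∨ e = y then m else 0) * g e
      = (if e = x then m * g e else 0) + (if e = y then m * g e else 0) := by
    intro e
    by_cases hx : e = x
    · subst hx
      simp [hxy]
    · simp [hx]
  simp [h, Finset.sum_add_distrib, mul_add]

/-- Let `f` assign a nonnegative flow to each pair of
intervals at time `t` (intervals `Iv 0 < Iv 1 < … ` of the partition of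
`[0,M)`).  If `e1 = (j1, j4)` and `e2 = (j2, j3)` are crossing edges
(`j1 < j2 ≤ j3 < j4`, the four intervals containing integers of `[0,M]`, with
positive flow on `e1` and `e2`), then moving `f_m = min (f e1) (f e2)` units of
flow from `e1, e2` to the uncrossed edges `e3 = (j1, j3)` and `e4 = (j2, j4)`
does not increase the flow cost `Σ_e f(e)·c_t(e,a)·w(a,t)` for any target. -/
theorem resolve_cross_cost
    (N M T P : ℕ) (R : ℝ) (hR : 0 ≤ R)
    (pos w : ℕ → ℕ → ℝ) (hw : ∀ a t', 0 ≤ w a t')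
    (hpos : ∀ a t', 1 ≤ a → a ≤ N → 0 ≤ pos a t' ∧ pos a t' ≤ (M : ℝ))
    (t : ℕ) (ht1 : 1 ≤ t) (ht2 : t ≤ T)
    (Iv : Fin P → ℝ × ℝ)
    (hIv : ∀ i : Fin P, 0 ≤ (Iv i).1 ∧ (Iv i).1 < (Iv i).2 ∧ (Iv i).2 ≤ (M : ℝ))
    (horder : ∀ i j : Fin P, i < j → (Iv i).2 ≤ (Iv j).1)
    (f : Fin P × Fin P → ℝ) (hf : ∀ e, 0 ≤ f e)
    (j1 j2 j3 j4 : Fin P) (h12 : j1 < j2) (h23 : j2 ≤ j3) (h34 : j3 < j4)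
    (hocc : ∀ j ∈ ({j1, j2, j3, j4} : Finset (Fin P)),
      ∃ z : ℤ, 0 ≤ (z : ℝ) ∧ (z : ℝ) ≤ (M : ℝ) ∧
        (Iv j).1 ≤ (z : ℝ) ∧ (z : ℝ) < (Iv j).2)
    (hpos1 : 0 < f (j1, j4)) (hpos2 : 0 < f (j2, j3)) :
    ∀ a, 1 ≤ a → a ≤ N →
      (∑ e : Fin P × Fin P,
        (f e
          - (if e = (j1, j4) ∨ e = (j2, j3) then min (f (j1, j4)) (f (j2, j3)) else 0)
          + (if e = (j1, j3) ∨ e = (j2, j4) then min (f (j1, j4)) (f (j2, j3)) else 0))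
          * cMid M R (pos a t) (Iv e.1) (Iv e.2) * w a t)
      ≤ ∑ e : Fin P × Fin P,
          f e * cMid M R (pos a t) (Iv e.1) (Iv e.2) * w a t := by
  intro a _ _
  set m := min (f (j1, j4)) (f (j2, j3)) with hm
  set g : Fin P × Fin P → ℝ := fun e => cMid M R (pos a t) (Iv e.1) (Iv e.2) * w a t with hg
  have hm0 : 0 ≤ m := le_min hpos1.le hpos2.le
  have hne : ((j1, j4) : Fin P × Fin P) ≠ (j2, j3) := fun h => h12.ne (Prod.ext_iff.mp h).1
  have hne' : ((j1, j3) : Fin P × Fin P) ≠ (j2, j4) := fun h => h12.ne (Prod.ext_iff.mp h).1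
  have hR12 : cRight M R (pos a t) (Iv j2) ≤ cRight M R (pos a t) (Iv j1) :=
    cRight_le_cRight (hIv j2).2.1.le (horder _ _ h12) (hocc j2 (by simp))
  have hL34 : cLeft M R (pos a t) (Iv j3) ≤ cLeft M R (pos a t) (Iv j4) :=
    cLeft_le_cLeft (hIv j3).2.1.le (horder _ _ h34) (hocc j3 (by simp))
  have hgle : g (j1, j3) + g (j2, j4) ≤ g (j1, j4) + g (j2, j3) := by
    simp only [hg, cMid_eq_cRight_mul_cLeft]
    have := mul_nonneg (mul_nonneg (sub_nonneg.2 hR12) (sub_nonneg.2 hL34)) (hw a t)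
    linarith
  have hle := mul_le_mul_of_nonneg_left hgle hm0
  have hsum := sum_ite_eq_or_eq_mul hne m g
  have hsum' := sum_ite_eq_or_eq_mul hne' m g
  simp only [mul_assoc, add_mul, sub_mul, Finset.sum_add_distrib, Finset.sum_sub_distrib]
  change _ - ∑ e, _ * g e + ∑ e, _ * g e ≤ _
  linarith
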